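/- Let h ∈ ℂ[X] be monic of degree d ≥ 1, let g_0,…,g_{d−1} ∈ ℂ[X], and set g(X) = ∑_{i=0}^{d−1} X^i · g_i(h(X)). Then for every w ∈ ℂ: ∑_{z ∈ roots(h−w), with multiplicity} g(z) = ∑_{i=0}^{d−1} s_i · g_i(w), where s_i = ∑_{z ∈ roots(h)} z^i is the i-th power sum of the roots of h (which, for 0 ≤ i ≤ d−1, equals the i-th power sum of the roots of h − w for every w ∈ ℂ). -/

import Mathlib

open Polynomial

/-- Newton's identity for the power sums of a multiset. -/
theorem Multiset.sum_map_pow_eq_mul_esymm_sub_sum {R : Type*} [CommRing R] (s : Multiset R)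
    (k : ℕ) (hk : 0 < k) :
    (s.map (fun z => z ^ k)).sum = (-1) ^ (k + 1) * k * s.esymm k -
      ∑ a ∈ Finset.HasAntidiagonal.antidiagonal k with a.1 ∈ Set.Ioo 0 k,
        (-1) ^ a.1 * s.esymm a.1 * (s.map (fun z => z ^ a.2)).sum := by
  obtain ⟨n, f, rfl⟩ : ∃ (n : ℕ) (f : Fin n → R), s = Finset.univ.val.map f :=
    ⟨s.toList.length, s.toList.get, by rw [Fin.univ_val_map, List.ofFn_get, s.coe_toList]⟩
  have hp (i : ℕ) : MvPolynomial.aeval f (MvPolynomial.psum (Fin n) R i)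
      = ((Finset.univ.val.map f).map (fun z => z ^ i)).sum := by
    simp only [MvPolynomial.psum, map_sum, map_pow, MvPolynomial.aeval_X, Multiset.map_map]
    rfl
  have hN := congrArg (MvPolynomial.aeval f) (MvPolynomial.psum_eq_mul_esymm_sub_sum (Fin n) R k hk)
  simpa only [map_sub, map_sum, map_mul, map_pow, map_neg, map_one, map_natCast, hp,
    MvPolynomial.aeval_esymm_eq_multiset_esymm] using hN

/-- The `k`-th power sum of a multiset is determined by its cardinality and its elementary
symmetric functions of order at most `k`. -/
theorem Multiset.sum_map_pow_eq_of_esymm_eq {R : Type*} [CommRing R] {s t : Multiset R}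
    (hcard : s.card = t.card) (k : ℕ) (hst : ∀ j ≤ k, s.esymm j = t.esymm j) :
    (s.map (fun z => z ^ k)).sum = (t.map (fun z => z ^ k)).sum := by
  induction k using Nat.strong_induction_on with
  | _ k ih =>
    rcases Nat.eq_zero_or_pos k with rfl | hk
    · simp [hcard]
    · rw [s.sum_map_pow_eq_mul_esymm_sub_sum k hk, t.sum_map_pow_eq_mul_esymm_sub_sum k hk,
        hst k le_rfl]
      congr 1
      refine Finset.sum_congr rfl fun a ha => ?_
      simp only [Finset.mem_filter, Finset.HasAntidiagonal.mem_antidiagonal, Set.mem_Ioo] at ha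
      rw [hst a.1 (by omega), ih a.2 (by omega) fun j hj => hst j (by omega)]

/-- Over an algebraically closed field, the power sums of order less than the degree of the roots
of a monic polynomial do not depend on its constant coefficient. -/
theorem Polynomial.sum_map_pow_roots_sub_C {K : Type*} [Field K] [IsAlgClosed K] {h : K[X]}
    (hmon : h.Monic) (w : K) {i : ℕ} (hi : i < h.natDegree) :
    ((h - C w).roots.map (fun z => z ^ i)).sum = (h.roots.map (fun z => z ^ i)).sum := by
  have hdeg : (h - C w).natDegree = h.natDegree := natDegree_sub_C
  have hmon' : (h - C w).Monic := by
    rw [Monic, leadingCoeff, hdeg, coeff_sub, coeff_C_of_ne_zero (by omega), sub_zero]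
    exact hmon
  have hcard (p : K[X]) : p.roots.card = p.natDegree :=
    (IsAlgClosed.splits p).natDegree_eq_card_roots.symm
  refine Multiset.sum_map_pow_eq_of_esymm_eq (by rw [hcard, hcard, hdeg]) i fun j hj => ?_
  have h₁ := coeff_eq_esymm_roots_of_card (hcard (h - C w)) (k := h.natDegree - j) (by omega)
  have h₂ := coeff_eq_esymm_roots_of_card (hcard h) (k := h.natDegree - j) (by omega)
  rw [coeff_sub, coeff_C_of_ne_zero (by omega), sub_zero, h₂, hmon, hmon', hdeg,
    Nat.sub_sub_self (by omega), one_mul] at h₁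
  exact (mul_left_cancel₀ (pow_ne_zero _ (neg_ne_zero.mpr one_ne_zero)) h₁).symm

/-- For monic `h` of degree `d ≥ 1` and `g(X) = ∑_{i<d} X^i gᵢ(h(X))`,
the sum of `g` over the fiber of `h` above any `w` (roots with multiplicity) equals
`∑_{i<d} sᵢ gᵢ(w)`, where `sᵢ` is the `i`-th power sum of the roots of `h`. -/
theorem stmt_7 (d : ℕ) (hd : 1 ≤ d) (h : Polynomial ℂ) (hmon : h.Monic)
    (hdeg : h.natDegree = d) (g₀ : ℕ → Polynomial ℂ) (g : Polynomial ℂ)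
    (hg : g = ∑ i ∈ Finset.range d, Polynomial.X ^ i * (g₀ i).comp h) (w : ℂ) :
    (((h - Polynomial.C w).roots).map (fun z => g.eval z)).sum
      = ∑ i ∈ Finset.range d, ((h.roots).map (fun z => z ^ i)).sum * (g₀ i).eval w := by
  subst hdeg
  have hfib : ∀ z ∈ (h - C w).roots, g.eval z
      = ∑ i ∈ Finset.range h.natDegree, z ^ i * (g₀ i).eval w := by
    intro z hz
    have hzw : h.eval z = w := by
      have := isRoot_of_mem_roots hz
      rwa [IsRoot, eval_sub, eval_C, sub_eq_zero] at this
    simp [hg, eval_finsetSum, hzw]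
  rw [Multiset.map_congr rfl hfib]
  refine (Multiset.sum_map_sum_map _ _).trans ?_
  refine Finset.sum_congr rfl fun i hi => ?_
  rw [Multiset.sum_map_mul_right, sum_map_pow_roots_sub_C hmon w (Finset.mem_range.mp hi)]
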